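/- arXiv:2507.11881 — 2 statements merged into one kernel-verified Lean document; each statement's English description precedes it below -/
import Mathlib

section
/- Let s > 3/2 and s−1 ≤ s' ≤ s+1. There exists a constant C > 0, depending only on s and s', such that for every Schwartz vector field j : ℝ³ → ℝ³ one has ∥(j·∇)j∥_{H^{s−1}} ≤ C ∥j∥_{H^s}². -/
open MeasureTheory SchwartzMap Real
open scoped FourierTransform

noncomputable section

/-- `ℝ³` as a Euclidean space. -/
abbrev E3 : Type := EuclideanSpace ℝ (Fin 3)

/-- The (squared-integral based) Sobolev `H^σ` norm of a complex-valued function on `ℝ³`,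
defined via the Fourier transform. -/
noncomputable def HNorm (σ : ℝ) (f : E3 → ℂ) : ℝ :=
  (∫ ξ : E3, (1 + ‖ξ‖ ^ 2) ^ σ * ‖𝓕 f ξ‖ ^ 2) ^ ((1 : ℝ) / 2)

/-- The Sobolev `H^σ` norm of a real-valued function. -/
noncomputable def HNormR (σ : ℝ) (f : E3 → ℝ) : ℝ :=
  HNorm σ (fun x => (f x : ℂ))

/-- The `j`-th partial derivative of a real-valued function on `ℝ³`. -/
noncomputable def pdR (j : Fin 3) (f : E3 → ℝ) : E3 → ℝ :=
  fun x => fderiv ℝ f x (EuclideanSpace.single j 1)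

/-- The `j`-th partial derivative of a complex-valued function on `ℝ³`. -/
noncomputable def pdC (j : Fin 3) (f : E3 → ℂ) : E3 → ℂ :=
  fun x => fderiv ℝ f x (EuclideanSpace.single j 1)

/-- The Sobolev `H^σ` norm of a vector field `u : ℝ³ → ℝ³`:
`∥u∥_{H^σ}² = Σ_i ∥u_i∥_{H^σ}²`. -/
noncomputable def VNorm (σ : ℝ) (u : Fin 3 → E3 → ℝ) : ℝ :=
  (∑ i : Fin 3, (HNormR σ (u i)) ^ 2) ^ ((1 : ℝ) / 2)

/-- `∥∇u∥_{H^σ}² = Σ_{i,j} ∥∂_j u_i∥_{H^σ}²` for a vector field `u : ℝ³ → ℝ³`. -/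
noncomputable def GradVNorm (σ : ℝ) (u : Fin 3 → E3 → ℝ) : ℝ :=
  (∑ i : Fin 3, ∑ j : Fin 3, (HNormR σ (pdR j (u i))) ^ 2) ^ ((1 : ℝ) / 2)

/-- The advection term `(u·∇)v`, with components `Σ_j u_j ∂_j v_i`. -/
noncomputable def adv (u v : Fin 3 → E3 → ℝ) : Fin 3 → E3 → ℝ :=
  fun i x => ∑ j : Fin 3, u j x * pdR j (v i) x

/-- The pointwise cross product of two vector fields on `ℝ³`. -/
noncomputable def crossVF (u v : Fin 3 → E3 → ℝ) : Fin 3 → E3 → ℝ :=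
  fun i x =>
    ![u 1 x * v 2 x - u 2 x * v 1 x,
      u 2 x * v 0 x - u 0 x * v 2 x,
      u 0 x * v 1 x - u 1 x * v 0 x] i

/-- A Schwartz vector field, viewed as a plain vector field. -/
noncomputable def toVF (u : Fin 3 → SchwartzMap E3 ℝ) : Fin 3 → E3 → ℝ :=
  fun i => ⇑(u i)

open scoped ENNReal LineDeriv Convolution

/-- Cauchy–Schwarz inequality for the Lebesgue integral, with squares. -/
lemma sq_lintegral_mul_le {α : Type*} [MeasurableSpace α] (μ : Measure α) {f g : α → ℝ≥0∞}
    (hf : AEMeasurable f μ) (hg : AEMeasurable g μ) :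
    (∫⁻ x, f x * g x ∂μ) ^ 2 ≤ (∫⁻ x, f x ^ 2 ∂μ) * ∫⁻ x, g x ^ 2 ∂μ := by
  have h := ENNReal.lintegral_mul_le_Lp_mul_Lq μ Real.HolderConjugate.two_two hf hg
  have hsq (a : ℝ≥0∞) : (a ^ (1 / (2 : ℝ))) ^ 2 = a := by
    rw [← ENNReal.rpow_mul_natCast]; norm_num
  calc (∫⁻ x, f x * g x ∂μ) ^ 2
      ≤ ((∫⁻ x, f x ^ (2 : ℝ) ∂μ) ^ (1 / (2 : ℝ)) * (∫⁻ x, g x ^ (2 : ℝ) ∂μ) ^ (1 / (2 : ℝ))) ^ 2 :=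
        pow_le_pow_left' h 2
    _ = _ := by simp [mul_pow, hsq, -one_div]

lemma ENNReal.add_sq_le_two_mul (a b : ℝ≥0∞) : (a + b) ^ 2 ≤ 2 * (a ^ 2 + b ^ 2) := by
  have h := ENNReal.rpow_add_le_mul_rpow_add_rpow a b (p := 2) (by norm_num)
  norm_num at h
  exact h

/-- Young's convolution inequality `L¹ ⋆ L² ⊆ L²`. -/
lemma lintegral_sq_conv_le {G : Type*} [AddCommGroup G] [MeasurableSpace G] [MeasurableAdd₂ G]
    [MeasurableNeg G] (μ : Measure G) [SFinite μ] [μ.IsAddLeftInvariant]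
    {f g : G → ℝ≥0∞} (hf : Measurable f) (hg : Measurable g) :
    ∫⁻ x, (∫⁻ y, f y * g (x - y) ∂μ) ^ 2 ∂μ ≤ (∫⁻ y, f y ∂μ) ^ 2 * ∫⁻ y, g y ^ 2 ∂μ := by
  have hsq (a : ℝ≥0∞) : (a ^ (1 / (2 : ℝ))) ^ 2 = a := by
    rw [← ENNReal.rpow_mul_natCast]; norm_num
  have hpt (x : G) : (∫⁻ y, f y * g (x - y) ∂μ) ^ 2 ≤
      (∫⁻ y, f y ∂μ) * ∫⁻ y, f y * g (x - y) ^ 2 ∂μ := by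
    have h := sq_lintegral_mul_le μ (f := fun y ↦ f y ^ (1 / (2 : ℝ)))
      (g := fun y ↦ f y ^ (1 / (2 : ℝ)) * g (x - y)) (by fun_prop) (by fun_prop)
    simpa only [← mul_assoc, ← sq, mul_pow, hsq] using h
  calc ∫⁻ x, (∫⁻ y, f y * g (x - y) ∂μ) ^ 2 ∂μ
      ≤ ∫⁻ x, (∫⁻ y, f y ∂μ) * ∫⁻ y, f y * g (x - y) ^ 2 ∂μ ∂μ := lintegral_mono hpt
    _ = (∫⁻ y, f y ∂μ) * ∫⁻ y, ∫⁻ x, f y * g (x - y) ^ 2 ∂μ ∂μ := by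
      rw [lintegral_const_mul _ (by fun_prop), lintegral_lintegral_swap (by fun_prop)]
    _ = (∫⁻ y, f y ∂μ) * ∫⁻ y, f y * ∫⁻ x, g x ^ 2 ∂μ ∂μ := by
      congr 1
      refine lintegral_congr fun y ↦ ?_
      rw [lintegral_const_mul _ (by fun_prop),
        lintegral_sub_right_eq_self (fun x ↦ g x ^ 2) y]
    _ = _ := by rw [lintegral_mul_const _ hf, sq, mul_assoc]

/-- The Fourier transform of a product of Schwartz functions is the convolution of the Fourier
transforms. -/
lemma SchwartzMap.fourier_pairing (f g : 𝓢(E3, ℂ)) (ξ : E3) :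
    𝓕 (pairing (ContinuousLinearMap.mul ℂ ℂ) f g) ξ = ∫ η, 𝓕 f η * 𝓕 g (ξ - η) := by
  have key : 𝓕⁻ (convolution (ContinuousLinearMap.mul ℂ ℂ) (𝓕 f) (𝓕 g)) =
      pairing (ContinuousLinearMap.mul ℂ ℂ) f g := by
    ext x
    have hneg (h : 𝓢(E3, ℂ)) : 𝓕⁻ h x = 𝓕 h (-x) := by
      rw [fourierInv_coe, fourier_coe, Real.fourierInv_eq_fourier_neg]
    rw [hneg, fourier_convolution, pairing_apply_apply, pairing_apply_apply, ← hneg, ← hneg]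
    simp
  rw [← key, FourierTransform.fourier_fourierInv_eq, convolution_apply]
  rfl

/-- The weight `⟨ξ⟩^{2r} = (1 + |ξ|²)^r`, as an extended nonnegative real. -/
def japaneseWeight (r : ℝ) (ξ : E3) : ℝ≥0∞ := ENNReal.ofReal ((1 + ‖ξ‖ ^ 2) ^ r)

@[fun_prop]
lemma measurable_japaneseWeight (r : ℝ) : Measurable (japaneseWeight r) := by
  unfold japaneseWeight; fun_prop

lemma japaneseWeight_mul (r t : ℝ) (ξ : E3) :
    japaneseWeight r ξ * japaneseWeight t ξ = japaneseWeight (r + t) ξ := by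
  unfold japaneseWeight
  rw [← ENNReal.ofReal_mul (by positivity), ← Real.rpow_add (by positivity)]

lemma japaneseWeight_sq (r : ℝ) (ξ : E3) :
    japaneseWeight (r / 2) ξ ^ 2 = japaneseWeight r ξ := by
  rw [sq, japaneseWeight_mul, add_halves]

lemma japaneseWeight_zero (ξ : E3) : japaneseWeight 0 ξ = 1 := by simp [japaneseWeight]

/-- The weight trade-off `⟨ξ⟩^{s-1} ⟨ξ-η⟩ ≲ ⟨η⟩^s + ⟨ξ-η⟩^s`. -/
lemma japaneseWeight_mul_le {s : ℝ} (hs : 1 ≤ s) (ξ η : E3) :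
    japaneseWeight ((s - 1) / 2) ξ * japaneseWeight (1 / 2) (ξ - η) ≤
      ENNReal.ofReal (4 ^ ((s - 1) / 2)) *
        (japaneseWeight (s / 2) η + japaneseWeight (s / 2) (ξ - η)) := by
  unfold japaneseWeight
  rw [← ENNReal.ofReal_mul (by positivity), ← ENNReal.ofReal_add (by positivity) (by positivity),
    ← ENNReal.ofReal_mul (by positivity)]
  refine ENNReal.ofReal_le_ofReal ?_
  set A := 1 + ‖η‖ ^ 2 with hA
  set B := 1 + ‖ξ - η‖ ^ 2 with hB
  have hA0 : 0 < A := by positivity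
  have hB0 : 0 < B := by positivity
  have hM0 : 0 < max A B := lt_max_of_lt_left hA0
  have hξ : 1 + ‖ξ‖ ^ 2 ≤ 4 * max A B := by
    have h1 : ‖ξ‖ ≤ ‖η‖ + ‖ξ - η‖ := by simpa using norm_add_le η (ξ - η)
    have h2 : ‖ξ‖ ^ 2 ≤ (‖η‖ + ‖ξ - η‖) ^ 2 := by gcongr
    nlinarith [le_max_left A B, le_max_right A B, sq_nonneg (‖η‖ - ‖ξ - η‖)]
  calc (1 + ‖ξ‖ ^ 2) ^ ((s - 1) / 2) * B ^ (1 / 2 : ℝ)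
      ≤ (4 * max A B) ^ ((s - 1) / 2) * max A B ^ (1 / 2 : ℝ) := by
        gcongr
        exact le_max_right A B
    _ = 4 ^ ((s - 1) / 2) * max A B ^ (s / 2) := by
        rw [Real.mul_rpow (by norm_num) hM0.le, mul_assoc, ← Real.rpow_add hM0]
        ring_nf
    _ ≤ 4 ^ ((s - 1) / 2) * (A ^ (s / 2) + B ^ (s / 2)) := by
        gcongr
        have h1 : 0 ≤ A ^ (s / 2) := by positivity
        have h2 : 0 ≤ B ^ (s / 2) := by positivity
        rcases max_choice A B with h | h <;> rw [h] <;> linarith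

lemma lintegral_japaneseWeight_neg_lt_top {s : ℝ} (hs : 3 / 2 < s) :
    ∫⁻ ξ, japaneseWeight (-s) ξ < ∞ := by
  have h := integrable_rpow_neg_one_add_norm_sq (E := E3) (μ := volume) (r := 2 * s)
    (by simp; linarith)
  have h2 := h.lintegral_lt_top
  simpa [japaneseWeight, neg_div] using h2

/-- Functions in weighted `L²` with weight exponent `s > 3/2` are in `L¹`. -/
lemma sq_lintegral_le_weighted (s : ℝ) {f : E3 → ℝ≥0∞} (hf : Measurable f) :
    (∫⁻ ξ, f ξ) ^ 2 ≤ (∫⁻ ξ, japaneseWeight (-s) ξ) * ∫⁻ ξ, japaneseWeight s ξ * f ξ ^ 2 := by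
  have h := sq_lintegral_mul_le volume (f := japaneseWeight (-s / 2))
    (g := fun ξ ↦ japaneseWeight (s / 2) ξ * f ξ) (by fun_prop) (by fun_prop)
  simp only [mul_pow, japaneseWeight_sq, ← mul_assoc, japaneseWeight_mul] at h
  simpa [neg_div, japaneseWeight_zero] using h

/-- The squared Sobolev norm, as an extended nonnegative real. -/
def eHSq (σ : ℝ) (f : E3 → ℂ) : ℝ≥0∞ := ∫⁻ ξ, japaneseWeight σ ξ * ‖𝓕 f ξ‖ₑ ^ 2

lemma enorm_fourier_lineDerivOp_le (g : 𝓢(E3, ℂ)) (m : E3) (ξ : E3) :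
    ‖𝓕 (∂_{m} g) ξ‖ₑ ≤
      ENNReal.ofReal (2 * π * ‖m‖) * (japaneseWeight (1 / 2) ξ * ‖𝓕 g ξ‖ₑ) := by
  have h1 : ‖𝓕 (∂_{m} g) ξ‖ ≤ (2 * π * ‖m‖) * ((1 + ‖ξ‖ ^ 2) ^ (1 / 2 : ℝ) * ‖𝓕 g ξ‖) := by
    rw [fourier_lineDerivOp_eq]
    have : ‖ξ‖ ≤ (1 + ‖ξ‖ ^ 2) ^ (1 / 2 : ℝ) := by
      rw [← Real.sqrt_eq_rpow]
      exact Real.le_sqrt_of_sq_le (by linarith)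
    have h2 := norm_inner_le_norm (𝕜 := ℝ) ξ m
    rw [smul_apply, smulLeftCLM_apply_apply (by fun_prop)]
    simp only [norm_smul, Complex.norm_mul, Complex.norm_ofNat, Complex.norm_real, Complex.norm_I,
      mul_one, Real.norm_of_nonneg Real.pi_pos.le]
    calc 2 * π * (‖inner ℝ ξ m‖ * ‖𝓕 g ξ‖) ≤ 2 * π * ((‖ξ‖ * ‖m‖) * ‖𝓕 g ξ‖) := by gcongr
      _ ≤ 2 * π * (((1 + ‖ξ‖ ^ 2) ^ (1 / 2 : ℝ) * ‖m‖) * ‖𝓕 g ξ‖) := by gcongr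
      _ = _ := by ring
  unfold japaneseWeight
  rw [← ofReal_norm, ← ofReal_norm, ← ENNReal.ofReal_mul (by positivity),
    ← ENNReal.ofReal_mul (by positivity)]
  exact ENNReal.ofReal_le_ofReal h1

/-- The product estimate `‖f ∂_m g‖_{H^{s-1}} ≲ ‖f‖_{H^s} ‖g‖_{H^s}`, `s > 3/2`, with squares. -/
lemma eHSq_mul_lineDerivOp_le {s : ℝ} (hs : 3 / 2 < s) (m : E3) :
    ∃ C : ℝ≥0∞, C ≠ ∞ ∧ ∀ f g : 𝓢(E3, ℂ),
      eHSq (s - 1) (fun x ↦ f x * ∂_{m} g x) ≤ C * (eHSq s f * eHSq s g) := by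
  set I := ∫⁻ ξ, japaneseWeight (-s) ξ
  have hI : I ≠ ∞ := (lintegral_japaneseWeight_neg_lt_top hs).ne
  set K := ENNReal.ofReal (2 * π * ‖m‖) * ENNReal.ofReal (4 ^ ((s - 1) / 2))
  have hK : K ≠ ∞ := ENNReal.mul_ne_top ENNReal.ofReal_ne_top ENNReal.ofReal_ne_top
  refine ⟨4 * (K ^ 2 * I), by finiteness, fun f g ↦ ?_⟩
  set F : E3 → ℝ≥0∞ := fun ξ ↦ ‖𝓕 f ξ‖ₑ with hF
  set G : E3 → ℝ≥0∞ := fun ξ ↦ ‖𝓕 g ξ‖ₑ with hG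
  have hFm : Measurable F := (𝓕 f).continuous.measurable.enorm
  have hGm : Measurable G := (𝓕 g).continuous.measurable.enorm
  set WF : E3 → ℝ≥0∞ := fun ξ ↦ japaneseWeight (s / 2) ξ * F ξ with hWF
  set WG : E3 → ℝ≥0∞ := fun ξ ↦ japaneseWeight (s / 2) ξ * G ξ with hWG
  have hWFm : Measurable WF := by fun_prop
  have hWGm : Measurable WG := by fun_prop
  have hWF2 : ∫⁻ ξ, WF ξ ^ 2 = eHSq s f := by
    simp [hWF, mul_pow, japaneseWeight_sq, eHSq, hF, fourier_coe]
  have hWG2 : ∫⁻ ξ, WG ξ ^ 2 = eHSq s g := by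
    simp [hWG, mul_pow, japaneseWeight_sq, eHSq, hG, fourier_coe]
  have hF1 : (∫⁻ ξ, F ξ) ^ 2 ≤ I * eHSq s f := by
    simpa [eHSq, fourier_coe, hF] using sq_lintegral_le_weighted s hFm
  have hG1 : (∫⁻ ξ, G ξ) ^ 2 ≤ I * eHSq s g := by
    simpa [eHSq, fourier_coe, hG] using sq_lintegral_le_weighted s hGm
  have hpt (ξ : E3) : japaneseWeight ((s - 1) / 2) ξ * ‖𝓕 (fun x ↦ f x * ∂_{m} g x) ξ‖ₑ ≤
      K * ((∫⁻ η, G η * WF (ξ - η)) + ∫⁻ η, F η * WG (ξ - η)) := by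
    have hprod : 𝓕 (fun x ↦ f x * ∂_{m} g x) ξ = ∫ η, 𝓕 f η * 𝓕 (∂_{m} g) (ξ - η) := by
      rw [← SchwartzMap.fourier_pairing, fourier_coe]; rfl
    have hswap : ∫⁻ η, G η * WF (ξ - η) = ∫⁻ η, WF η * G (ξ - η) := by
      rw [← lintegral_sub_left_eq_self _ ξ]
      simp [mul_comm]
    rw [hprod, hswap, ← lintegral_add_left (by fun_prop), ← lintegral_const_mul _ (by fun_prop)]
    calc _ ≤ japaneseWeight ((s - 1) / 2) ξ * ∫⁻ η, ‖𝓕 f η * 𝓕 (∂_{m} g) (ξ - η)‖ₑ := by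
          gcongr; exact enorm_integral_le_lintegral_enorm _
      _ = ∫⁻ η, japaneseWeight ((s - 1) / 2) ξ * ‖𝓕 f η * 𝓕 (∂_{m} g) (ξ - η)‖ₑ := by
          have := (𝓕 f).continuous
          have := (𝓕 (∂_{m} g)).continuous
          rw [lintegral_const_mul _ (by fun_prop)]
      _ ≤ _ := by
          refine lintegral_mono fun η ↦ ?_
          calc japaneseWeight ((s - 1) / 2) ξ * ‖𝓕 f η * 𝓕 (∂_{m} g) (ξ - η)‖ₑ
              ≤ japaneseWeight ((s - 1) / 2) ξ * (F η * (ENNReal.ofReal (2 * π * ‖m‖) *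
                  (japaneseWeight (1 / 2) (ξ - η) * G (ξ - η)))) := by
                rw [enorm_mul]
                gcongr
                exact enorm_fourier_lineDerivOp_le g m _
            _ = ENNReal.ofReal (2 * π * ‖m‖) * (japaneseWeight ((s - 1) / 2) ξ *
                  japaneseWeight (1 / 2) (ξ - η)) * (F η * G (ξ - η)) := by ring
            _ ≤ ENNReal.ofReal (2 * π * ‖m‖) * (ENNReal.ofReal (4 ^ ((s - 1) / 2)) *
                  (japaneseWeight (s / 2) η + japaneseWeight (s / 2) (ξ - η))) *
                    (F η * G (ξ - η)) := by
                gcongr ENNReal.ofReal (2 * π * ‖m‖) * ?_ * (F η * G (ξ - η))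
                exact japaneseWeight_mul_le (by linarith) ξ η
            _ = K * (WF η * G (ξ - η) + F η * WG (ξ - η)) := by
                simp only [K, hWF, hWG]; ring
  calc eHSq (s - 1) (fun x ↦ f x * ∂_{m} g x)
      = ∫⁻ ξ, (japaneseWeight ((s - 1) / 2) ξ * ‖𝓕 (fun x ↦ f x * ∂_{m} g x) ξ‖ₑ) ^ 2 := by
        simp [eHSq, mul_pow, japaneseWeight_sq]
    _ ≤ ∫⁻ ξ, 2 * K ^ 2 * ((∫⁻ η, G η * WF (ξ - η)) ^ 2 + (∫⁻ η, F η * WG (ξ - η)) ^ 2) := by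
        refine lintegral_mono fun ξ ↦ (pow_le_pow_left' (hpt ξ) 2).trans ?_
        rw [mul_pow, mul_comm 2 (K ^ 2), mul_assoc]
        gcongr
        exact ENNReal.add_sq_le_two_mul _ _
    _ = 2 * K ^ 2 * ((∫⁻ ξ, (∫⁻ η, G η * WF (ξ - η)) ^ 2) +
          ∫⁻ ξ, (∫⁻ η, F η * WG (ξ - η)) ^ 2) := by
        rw [lintegral_const_mul _ (by fun_prop), lintegral_add_left (by fun_prop)]
    _ ≤ 2 * K ^ 2 * ((I * eHSq s g) * eHSq s f + (I * eHSq s f) * eHSq s g) := by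
        gcongr
        · exact (lintegral_sq_conv_le volume hGm hWFm).trans (by rw [hWF2]; gcongr)
        · exact (lintegral_sq_conv_le volume hFm hWGm).trans (by rw [hWG2]; gcongr)
    _ = _ := by ring

lemma eHSq_lt_top (σ : ℝ) (f : 𝓢(E3, ℂ)) : eHSq σ f < ∞ := by
  have hw := Function.hasTemperateGrowth_one_add_norm_sq_rpow E3 (σ / 2)
  have h := (smulLeftCLM ℂ (fun x : E3 ↦ (1 + ‖x‖ ^ 2) ^ (σ / 2)) (𝓕 f)).memLp 2 volume
  have h2 := lintegral_rpow_enorm_lt_top_of_eLpNorm_lt_top two_ne_zero ENNReal.ofNat_ne_top h.2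
  refine lt_of_eq_of_lt ?_ h2
  unfold eHSq
  refine lintegral_congr fun ξ ↦ ?_
  rw [smulLeftCLM_apply_apply hw, enorm_smul, fourier_coe, Real.enorm_of_nonneg (by positivity),
    ENNReal.toReal_ofNat, ENNReal.rpow_ofNat, mul_pow, ← japaneseWeight_sq]
  rfl

lemma HNorm_sq (σ : ℝ) (f : 𝓢(E3, ℂ)) : HNorm σ f ^ 2 = (eHSq σ f).toReal := by
  have hnn (ξ : E3) : 0 ≤ (1 + ‖ξ‖ ^ 2) ^ σ * ‖𝓕 (⇑f) ξ‖ ^ 2 := by positivity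
  have hc : Measurable (𝓕 (⇑f)) := by
    rw [← fourier_coe]; exact (𝓕 f).continuous.measurable
  rw [HNorm, ← Real.rpow_mul_natCast (integral_nonneg hnn)]
  norm_num
  rw [integral_eq_lintegral_of_nonneg_ae (.of_forall hnn) (by fun_prop)]
  congr 1
  refine lintegral_congr fun ξ ↦ ?_
  rw [ENNReal.ofReal_mul (by positivity), ENNReal.ofReal_pow (by positivity), ofReal_norm]
  rfl

/-- The complexification of a real-valued Schwartz function. -/
def SchwartzMap.complexify (f : 𝓢(E3, ℝ)) : 𝓢(E3, ℂ) := f.postcompCLM Complex.ofRealCLM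

lemma SchwartzMap.complexify_apply (f : 𝓢(E3, ℝ)) (x : E3) : f.complexify x = (f x : ℂ) := rfl

lemma SchwartzMap.lineDerivOp_complexify_apply (f : 𝓢(E3, ℝ)) (k : Fin 3) (x : E3) :
    ∂_{EuclideanSpace.single k (1 : ℝ)} f.complexify x = (pdR k f x : ℂ) := by
  have h : HasFDerivAt f.complexify (Complex.ofRealCLM ∘L fderiv ℝ f x) x :=
    Complex.ofRealCLM.hasFDerivAt.comp x f.differentiableAt.hasFDerivAt
  rw [lineDerivOp_apply_eq_fderiv, h.fderiv]
  rfl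

lemma eHSq_sum_le (σ : ℝ) (h : Fin 3 → 𝓢(E3, ℂ)) :
    eHSq σ (∑ k, h k : 𝓢(E3, ℂ)) ≤ 4 * ∑ k, eHSq σ (h k) := by
  have hm (k : Fin 3) : Measurable (𝓕 (h k) : 𝓢(E3, ℂ)) := (𝓕 (h k)).continuous.measurable
  simp only [eHSq, Fin.sum_univ_three, ← fourier_coe, FourierTransform.fourier_add, add_apply]
  rw [← lintegral_add_left (by fun_prop), ← lintegral_add_left (by fun_prop),
    ← lintegral_const_mul _ (by fun_prop)]
  refine lintegral_mono fun ξ ↦ ?_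
  set a := ‖𝓕 (h 0) ξ‖ₑ
  set b := ‖𝓕 (h 1) ξ‖ₑ
  set c := ‖𝓕 (h 2) ξ‖ₑ
  calc japaneseWeight σ ξ * ‖𝓕 (h 0) ξ + 𝓕 (h 1) ξ + 𝓕 (h 2) ξ‖ₑ ^ 2
      ≤ japaneseWeight σ ξ * (a + b + c) ^ 2 := by
        gcongr
        exact (enorm_add_le _ _).trans (by gcongr; exact enorm_add_le _ _)
    _ ≤ japaneseWeight σ ξ * (2 * (2 * (a ^ 2 + b ^ 2) + 2 * c ^ 2)) := by
        gcongr
        refine (ENNReal.add_sq_le_two_mul _ _).trans ?_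
        gcongr
        · exact ENNReal.add_sq_le_two_mul _ _
        · exact le_mul_of_one_le_left' one_le_two
    _ = _ := by ring

/-- The advection term of a Schwartz vector field, complexified, as a Schwartz vector field. -/
def advSchwartz (u : Fin 3 → 𝓢(E3, ℝ)) (i : Fin 3) : 𝓢(E3, ℂ) :=
  ∑ k, pairing (ContinuousLinearMap.mul ℂ ℂ) (u k).complexify
    (∂_{EuclideanSpace.single k (1 : ℝ)} (u i).complexify)

lemma advSchwartz_apply (u : Fin 3 → 𝓢(E3, ℝ)) (i : Fin 3) (x : E3) :
    advSchwartz u i x = (adv (toVF u) (toVF u) i x : ℂ) := by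
  simp [advSchwartz, adv, toVF, pairing_apply_apply, complexify_apply,
    lineDerivOp_complexify_apply]

lemma VNorm_eq (σ : ℝ) {u : Fin 3 → E3 → ℝ} (v : Fin 3 → 𝓢(E3, ℂ))
    (h : ∀ i x, v i x = (u i x : ℂ)) : VNorm σ u = √(∑ i, eHSq σ (v i)).toReal := by
  have h' (i : Fin 3) : (fun x ↦ (u i x : ℂ)) = v i := funext fun x ↦ (h i x).symm
  simp only [VNorm, HNormR, h', HNorm_sq]
  rw [← Real.sqrt_eq_rpow, ENNReal.toReal_sum fun i _ ↦ (eHSq_lt_top σ (v i)).ne]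

lemma sum_eHSq_advSchwartz_le {s : ℝ} (hs : 3 / 2 < s) :
    ∃ C : ℝ≥0∞, C ≠ ∞ ∧ ∀ u : Fin 3 → 𝓢(E3, ℝ),
      ∑ i, eHSq (s - 1) (advSchwartz u i) ≤ C * (∑ i, eHSq s (u i).complexify) ^ 2 := by
  choose C hC hle using fun k : Fin 3 ↦
    eHSq_mul_lineDerivOp_le hs (EuclideanSpace.single k (1 : ℝ))
  refine ⟨4 * ∑ k, C k, ENNReal.mul_ne_top (by simp) (by simp [hC]), fun u ↦ ?_⟩
  calc ∑ i, eHSq (s - 1) (advSchwartz u i)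
      ≤ ∑ i, 4 * ∑ k, (∑ l, C l) * (eHSq s (u k).complexify * eHSq s (u i).complexify) := by
        gcongr with i
        refine (eHSq_sum_le _ _).trans ?_
        gcongr with k
        refine (hle k (u k).complexify (u i).complexify).trans ?_
        gcongr
        exact Finset.single_le_sum (f := C) (fun _ _ ↦ zero_le) (Finset.mem_univ k)
    _ = _ := by
        rw [sq, Finset.sum_mul_sum, Finset.sum_comm]
        simp only [← Finset.mul_sum, mul_assoc]

/-- Lemma 2.7: `∥(j·∇)j∥_{H^{s−1}} ≤ C ∥j∥_{H^s}²`
for `s > 3/2`, `s−1 ≤ s' ≤ s+1` and Schwartz vector fields `j`. -/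
theorem advection_estimate_jj (s s' : ℝ) (hs : 3 / 2 < s)
    (hs'1 : s - 1 ≤ s') (hs'2 : s' ≤ s + 1) :
    ∃ C : ℝ, 0 < C ∧ ∀ j : Fin 3 → SchwartzMap E3 ℝ,
      VNorm (s - 1) (adv (toVF j) (toVF j)) ≤
        C * VNorm s (toVF j) ^ 2 := by
  obtain ⟨C, hC, hle⟩ := sum_eHSq_advSchwartz_le hs
  refine ⟨√C.toReal + 1, by positivity, fun j ↦ ?_⟩
  have hj : ∑ i, eHSq s (j i).complexify ≠ ∞ :=
    ENNReal.sum_ne_top.2 fun i _ ↦ (eHSq_lt_top s _).ne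
  rw [VNorm_eq (s - 1) (advSchwartz j) (advSchwartz_apply j),
    VNorm_eq s (u := toVF j) (fun i ↦ (j i).complexify) (fun i ↦ (j i).complexify_apply),
    Real.sq_sqrt ENNReal.toReal_nonneg]
  have h := ENNReal.toReal_mono (by finiteness) (hle j)
  rw [ENNReal.toReal_mul, ENNReal.toReal_pow] at h
  calc √(∑ i, eHSq (s - 1) (advSchwartz j i)).toReal
      ≤ √(C.toReal * (∑ i, eHSq s (j i).complexify).toReal ^ 2) := Real.sqrt_le_sqrt h
    _ = √C.toReal * (∑ i, eHSq s (j i).complexify).toReal := by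
        rw [Real.sqrt_mul ENNReal.toReal_nonneg, Real.sqrt_sq ENNReal.toReal_nonneg]
    _ ≤ _ := by gcongr; linarith

end
end

section
/- Let C > 0. Let 𝓔 : [0,∞) → [0,∞) be continuously differentiable and 𝓓 : [0,∞) → [0,∞) be continuous, and assume that (1/2)𝓔'(t) + 𝓓(t) ≤ C 𝓔(t)^{1/2} 𝓓(t) for all t ≥ 0, and that C 𝓔(0)^{1/2} ≤ 1/4. Then C 𝓔(t)^{1/2} ≤ 1/2 for all t ≥ 0; moreover 𝓔 is nonincreasing, so 𝓔(t) ≤ 𝓔(0) for all t ≥ 0, and ∫_0^∞ 𝓓(t) dt ≤ 𝓔(0). -/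
open MeasureTheory Set
open scoped ENNReal

/-- A function that is at most `a` initially, and whose right derivative is nonpositive whenever its
value is at most `b`, never exceeds `b` if `a < b`. -/
theorem le_of_deriv_nonpos_of_le {f f' : ℝ → ℝ} {a b : ℝ} (hab : a < b)
    (hderiv : ∀ t ∈ Ici (0 : ℝ), HasDerivWithinAt f (f' t) (Ici 0) t) (hinit : f 0 ≤ a)
    (hnonpos : ∀ t ∈ Ici (0 : ℝ), f t ≤ b → f' t ≤ 0) :
    ∀ t ∈ Ici (0 : ℝ), f t ≤ b := by
  intro T hT
  have hT0 : 0 ≤ T := hT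
  have hε : 0 < (b - a) / (T + 1) := div_pos (sub_pos.2 hab) (by linarith)
  have hεT : (b - a) / (T + 1) * (T + 1) = b - a := div_mul_cancel₀ _ (by linarith)
  set ε := (b - a) / (T + 1)
  have hbarrier : ∀ x ∈ Icc 0 T, a + ε * x ≤ b := fun x hx => by
    nlinarith [mul_le_mul_of_nonneg_left hx.2 hε.le]
  have key := image_le_of_deriv_right_lt_deriv_boundary (f := f) (f' := f') (a := 0) (b := T)
    (B := fun x => a + ε * x) (B' := fun _ => ε)
    (fun x hx => ((hderiv x hx.1).continuousWithinAt).mono Icc_subset_Ici_self)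
    (fun x hx => (hderiv x hx.1).mono (Ici_subset_Ici.2 hx.1))
    (by simpa using hinit)
    (fun x => by simpa using ((hasDerivAt_id x).const_mul ε).const_add a)
    (fun x hx hfx => (hnonpos x hx.1
      (hfx.trans_le (hbarrier x (Ico_subset_Icc_self hx)))).trans_lt hε)
  exact (key (right_mem_Icc.2 hT0)).trans (hbarrier T (right_mem_Icc.2 hT0))

/-- If a nonnegative function `f` satisfies `f' ≤ -g` on `[0, ∞)` with `g ≥ 0` continuous, then
`∫₀^∞ g ≤ f 0`. -/
theorem lintegral_Ioi_le_of_deriv_le_neg {f f' g : ℝ → ℝ}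
    (hf : ∀ t ∈ Ici (0 : ℝ), 0 ≤ f t) (hg : ∀ t ∈ Ici (0 : ℝ), 0 ≤ g t)
    (hderiv : ∀ t ∈ Ici (0 : ℝ), HasDerivWithinAt f (f' t) (Ici 0) t)
    (hgcont : ContinuousOn g (Ici 0)) (hle : ∀ t ∈ Ici (0 : ℝ), f' t ≤ -g t) :
    ∫⁻ t in Ioi (0 : ℝ), ENNReal.ofReal (g t) ≤ ENNReal.ofReal (f 0) := by
  have hgint : ∀ T : ℝ, IntegrableOn g (Icc 0 T) := fun T =>
    (hgcont.mono Icc_subset_Ici_self).integrableOn_Icc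
  have hbound : ∀ T : ℝ, 0 ≤ T → ∫ t in (0 : ℝ)..T, g t ≤ f 0 := by
    intro T hT
    have h := intervalIntegral.integral_le_sub_of_hasDeriv_right_of_le (g := fun t => -f t)
      (g' := fun t => -f' t) hT
      (fun x hx => ((hderiv x hx.1).continuousWithinAt.mono Icc_subset_Ici_self).neg)
      (fun x hx => ((hderiv x hx.1.le).mono
        (Ioi_subset_Ici hx.1.le)).fun_neg)
      (hgint T) (fun x hx => le_neg_of_le_neg (hle x hx.1.le))
    linarith [hf T hT]
  have hint : IntegrableOn g (Ioi 0) := by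
    refine integrableOn_Ioi_of_intervalIntegral_norm_bounded (f 0) 0 (l := Filter.atTop)
      (b := id) (fun T => (hgint T).mono_set Ioc_subset_Icc_self) Filter.tendsto_id ?_
    filter_upwards [Filter.eventually_ge_atTop 0] with T hT
    refine le_of_eq_of_le (intervalIntegral.integral_congr fun t ht => ?_) (hbound T hT)
    rw [id, uIcc_of_le hT] at ht
    exact Real.norm_of_nonneg (hg t ht.1)
  rw [← ofReal_integral_eq_lintegral_ofReal hint
    ((ae_restrict_mem measurableSet_Ioi).mono fun t ht => hg t (Ioi_subset_Ici_self ht))]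
  refine ENNReal.ofReal_le_ofReal (le_of_tendsto
    (intervalIntegral_tendsto_integral_Ioi 0 hint Filter.tendsto_id) ?_)
  filter_upwards [Filter.eventually_ge_atTop 0] with T hT using hbound T hT

/-- The bootstrap/continuity argument from the third step of the proof of Theorem 1.1:
if `(1/2)𝓔' + 𝓓 ≤ C 𝓔^{1/2} 𝓓` on `[0,∞)` and `C 𝓔(0)^{1/2} ≤ 1/4`, then
`C 𝓔(t)^{1/2} ≤ 1/2` for all `t ≥ 0`, `𝓔` is nonincreasing (so `𝓔(t) ≤ 𝓔(0)`),
and `∫_0^∞ 𝓓 ≤ 𝓔(0)`. -/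
theorem bootstrap_energy (C : ℝ) (hC : 0 < C) (𝓔 𝓔' 𝓓 : ℝ → ℝ)
    (h𝓔nn : ∀ t ∈ Ici (0 : ℝ), 0 ≤ 𝓔 t)
    (h𝓓nn : ∀ t ∈ Ici (0 : ℝ), 0 ≤ 𝓓 t)
    (h𝓔deriv : ∀ t ∈ Ici (0 : ℝ), HasDerivWithinAt 𝓔 (𝓔' t) (Ici 0) t)
    (h𝓔'cont : ContinuousOn 𝓔' (Ici 0))
    (h𝓓cont : ContinuousOn 𝓓 (Ici 0))
    (hineq : ∀ t ∈ Ici (0 : ℝ), (1 / 2) * 𝓔' t + 𝓓 t ≤ C * Real.sqrt (𝓔 t) * 𝓓 t)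
    (hinit : C * Real.sqrt (𝓔 0) ≤ 1 / 4) :
    (∀ t ∈ Ici (0 : ℝ), C * Real.sqrt (𝓔 t) ≤ 1 / 2) ∧
    AntitoneOn 𝓔 (Ici (0 : ℝ)) ∧
    (∀ t ∈ Ici (0 : ℝ), 𝓔 t ≤ 𝓔 0) ∧
    ∫⁻ t in Ioi (0 : ℝ), ENNReal.ofReal (𝓓 t) ≤ ENNReal.ofReal (𝓔 0) := by
  have hsqrt : ∀ {x c : ℝ}, 0 ≤ c → (C * Real.sqrt x ≤ c ↔ x ≤ (c / C) ^ 2) := fun hc => by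
    rw [← Real.sqrt_le_left (div_nonneg hc hC.le), le_div_iff₀' hC]
  have hdecay : ∀ t ∈ Ici (0 : ℝ), C * Real.sqrt (𝓔 t) ≤ 1 / 2 → 𝓔' t ≤ -𝓓 t := fun t ht h => by
    nlinarith [hineq t ht, mul_le_mul_of_nonneg_right h (h𝓓nn t ht)]
  have hsmall : ∀ t ∈ Ici (0 : ℝ), C * Real.sqrt (𝓔 t) ≤ 1 / 2 := by
    have hlt : (1 / 4 / C) ^ 2 < (1 / 2 / C) ^ 2 := by gcongr; norm_num
    intro t ht
    refine (hsqrt (by norm_num)).2 (le_of_deriv_nonpos_of_le hlt h𝓔deriv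
      ((hsqrt (by norm_num)).1 hinit) (fun s hs h => ?_) t ht)
    linarith [hdecay s hs ((hsqrt (by norm_num)).2 h), h𝓓nn s hs]
  have hle : ∀ t ∈ Ici (0 : ℝ), 𝓔' t ≤ -𝓓 t := fun t ht => hdecay t ht (hsmall t ht)
  have hanti : AntitoneOn 𝓔 (Ici 0) := by
    refine antitoneOn_of_hasDerivWithinAt_nonpos (convex_Ici 0)
      (fun t ht => (h𝓔deriv t ht).continuousWithinAt)
      (fun t ht => (h𝓔deriv t (interior_subset ht)).mono interior_subset) fun t ht => ?_
    linarith [hle t (interior_subset ht), h𝓓nn t (interior_subset ht)]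
  exact ⟨hsmall, hanti, fun t ht => hanti self_mem_Ici ht ht,
    lintegral_Ioi_le_of_deriv_le_neg h𝓔nn h𝓓nn h𝓔deriv h𝓓cont hle⟩
end
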